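/- The vector space L̂_{r+1,k}(g) = (g ⊗ O) ⊕ K ⊕ D_+ with the bracket determined by: [a ⊗ t₀^{m₀} t^m, b ⊗ t₀^{n₀} t^n] = [a,b] ⊗ t₀^{m₀+n₀} t^{m+n} + k(a|b) Σ_{i=0}^r m_i K_i ⊗ t₀^{m₀+n₀} t^{m+n}; [K, L̂_{r+1,k}(g)] = 0 except as specified next; [d_i ⊗ t₀^{m₀} t^m, a ⊗ t₀^{n₀} t^n] = n_i a ⊗ t₀^{m₀+n₀} t^{m+n}; [d_i ⊗ t₀^{m₀} t^m, K_j ⊗ t₀^{n₀} t^n] = n_i K_j ⊗ t₀^{m₀+n₀} t^{m+n} + δ_{i,j} Σ_{l=0}^r m_l K_l ⊗ t₀^{m₀+n₀} t^{m+n}; and [d_i ⊗ t₀^{m₀} t^m, d_j ⊗ t₀^{n₀} t^n] = n_i d_j ⊗ t₀^{m₀+n₀} t^{m+n} − m_j d_i ⊗ t₀^{m₀+n₀} t^{m+n} − n_i m_j Σ_{l=0}^r m_l K_l ⊗ t₀^{m₀+n₀} t^{m+n}, is a Lie algebra over ℂ (the bracket is well defined on the quotient K, alternating, and satisfies the Jacobi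 identity). -/

import Mathlib

/-- Exponents of monomials `t₀^{m₀} t^m = t₀^{m₀} t₁^{m₁} ⋯ t_r^{m_r}`. -/
abbrev TorIdx (r : ℕ) := ℤ × (Fin r → ℤ)

/-- The free module `⊕_{i=0}^r ℂK_i ⊗ O`, with basis `K_i ⊗ t₀^{m₀} t^m`
indexed by `(i, (m₀, m))`. -/
abbrev CF (r : ℕ) := (Fin (r + 1) × TorIdx r) →₀ ℂ

/-- The element `Σ_{l=0}^r c_l K_l ⊗ t₀^{e₀} t^e` where `(c_0, c_1, …, c_r) =
(m₀, m₁, …, m_r)`. -/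
noncomputable def consSum (r : ℕ) (m₀ : ℤ) (m : Fin r → ℤ) (e₀ : ℤ) (e : Fin r → ℤ) : CF r :=
  ∑ l : Fin (r + 1), Finsupp.single (l, (e₀, e)) (((Fin.cons m₀ m : Fin (r + 1) → ℤ) l : ℤ) : ℂ)

/-- The element `Σ_{i=0}^r m_i K_i ⊗ t₀^{m₀} t^m` spanning the relations. -/
noncomputable def relElem (r : ℕ) (m₀ : ℤ) (m : Fin r → ℤ) : CF r :=
  consSum r m₀ m m₀ m

/-- The subspace of relations, so that `K = CF r ⧸ RR r`. -/
noncomputable def RR (r : ℕ) : Submodule ℂ (CF r) :=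
  Submodule.span ℂ {x : CF r | ∃ (m₀ : ℤ) (m : Fin r → ℤ), x = relElem r m₀ m}

/-- The `g ⊗ O`-component of the bracket:
`[a ⊗ t₀^{m₀}t^m, b ⊗ t₀^{n₀}t^n] ↦ [a,b] ⊗ t₀^{m₀+n₀}t^{m+n}`, where `g ⊗ O`
is modelled as finitely supported functions `TorIdx r →₀ g`. -/
noncomputable def ggPart (r : ℕ) (g : Type*) [LieRing g] [LieAlgebra ℂ g]
    (f f' : TorIdx r →₀ g) : TorIdx r →₀ g :=
  f.sum fun p a => f'.sum fun q b => Finsupp.single (p.1 + q.1, p.2 + q.2) ⁅a, b⁆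

/-- The central component of the bracket (before passing to the quotient `K`):
`k(a|b) Σ_{i=0}^r m_i K_i ⊗ t₀^{m₀+n₀} t^{m+n}`. -/
noncomputable def centPart (r : ℕ) (g : Type*) [LieRing g] [LieAlgebra ℂ g]
    (k : ℂ) (B : g →ₗ[ℂ] g →ₗ[ℂ] ℂ) (f f' : TorIdx r →₀ g) : CF r :=
  f.sum fun p a => f'.sum fun q b =>
    (k * B a b) • consSum r p.1 p.2 (p.1 + q.1) (p.2 + q.2)


/-- The action of the derivation `d_i ⊗ t₀^{m₀} t^m` on `g ⊗ O`. -/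
noncomputable def derG (r : ℕ) (g : Type*) [LieRing g] [LieAlgebra ℂ g]
    (m₀ : ℤ) (m : Fin r → ℤ) (i : Fin r) (f : TorIdx r →₀ g) : TorIdx r →₀ g :=
  f.sum fun q a => Finsupp.single (m₀ + q.1, m + q.2) (((q.2 i : ℤ) : ℂ) • a)

/-- The action of the derivation `d_i ⊗ t₀^{m₀} t^m` on `⊕_{j=0}^r ℂK_j ⊗ O`. -/
noncomputable def derK (r : ℕ) (m₀ : ℤ) (m : Fin r → ℤ) (i : Fin r) (u : CF r) : CF r :=
  u.sum fun jq c => c •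
    (Finsupp.single (jq.1, (m₀ + jq.2.1, m + jq.2.2)) ((jq.2.2 i : ℤ) : ℂ)
      + (if jq.1 = i.succ then consSum r m₀ m (m₀ + jq.2.1) (m + jq.2.2) else 0))

/-- `D_+ = ⊕_{i=1}^r ℂ d_i ⊗ O`, with basis `d_i ⊗ t₀^{m₀} t^m`. -/
abbrev DPlus (r : ℕ) := (Fin r × TorIdx r) →₀ ℂ

/-- The `D_+`-component of `[d_i ⊗ t₀^{m₀}t^m, d_j ⊗ t₀^{n₀}t^n]`, namely
`n_i d_j ⊗ t₀^{m₀+n₀}t^{m+n} − m_j d_i ⊗ t₀^{m₀+n₀}t^{m+n}`. -/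
noncomputable def brD (r : ℕ) (x y : DPlus r) : DPlus r :=
  x.sum fun p c => y.sum fun q c' => (c * c') •
    (((q.2.2 p.1 : ℤ) : ℂ) • Finsupp.single (q.1, (p.2.1 + q.2.1, p.2.2 + q.2.2)) (1 : ℂ)
      - ((p.2.2 q.1 : ℤ) : ℂ) • Finsupp.single (p.1, (p.2.1 + q.2.1, p.2.2 + q.2.2)) (1 : ℂ))

/-- The action of `D_+` on `⊕_{j=0}^r ℂK_j ⊗ O`, extended bilinearly. -/
noncomputable def actD (r : ℕ) (d : DPlus r) (u : CF r) : CF r :=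
  d.sum fun p c => c • derK r p.2.1 p.2.2 p.1 u

/-- The action of `D_+` on `g ⊗ O`, extended bilinearly. -/
noncomputable def actG (r : ℕ) (g : Type*) [LieRing g] [LieAlgebra ℂ g]
    (d : DPlus r) (f : TorIdx r →₀ g) : TorIdx r →₀ g :=
  d.sum fun p c => c • derG r g p.2.1 p.2.2 p.1 f

/-- The `K`-valued `2`-cocycle on `D_+` (before passing to the quotient):
`[d_i ⊗ t₀^{m₀}t^m, d_j ⊗ t₀^{n₀}t^n] ∋ − n_i m_j Σ_{l=0}^r m_l K_l ⊗
t₀^{m₀+n₀}t^{m+n}`. -/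
noncomputable def ddCocycle (r : ℕ) (d e : DPlus r) : CF r :=
  d.sum fun p c => e.sum fun q c' =>
    (-(c * c') * ((q.2.2 p.1 : ℤ) : ℂ) * ((p.2.2 q.1 : ℤ) : ℂ)) •
      consSum r p.2.1 p.2.2 (p.2.1 + q.2.1) (p.2.2 + q.2.2)

open Finsupp

section BilinearSum

variable {ι κ R M N P : Type*} [CommSemiring R] [AddCommMonoid M] [Module R M]
  [AddCommMonoid N] [Module R N] [AddCommMonoid P] [Module R P]

/-- The bilinear map on finitely supported functions assembled from a family of bilinear maps. -/
noncomputable def bilinSum (F : ι → κ → M →ₗ[R] N →ₗ[R] P) :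
    (ι →₀ M) →ₗ[R] (κ →₀ N) →ₗ[R] P :=
  Finsupp.lsum R fun i => (Finsupp.lsum R fun j => (F i j).flip).flip

theorem bilinSum_apply (F : ι → κ → M →ₗ[R] N →ₗ[R] P) (f : ι →₀ M) (f' : κ →₀ N) :
    bilinSum F f f' = f.sum fun i a => f'.sum fun j b => F i j a b := by
  simp [bilinSum, Finsupp.sum, LinearMap.sum_apply]

theorem bilinSum_single_single (F : ι → κ → M →ₗ[R] N →ₗ[R] P) (i : ι) (j : κ) (a : M) (b : N) :
    bilinSum F (single i a) (single j b) = F i j a b := by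
  simp [bilinSum]

end BilinearSum

namespace Toroidal

variable {r : ℕ}

/-- `consSum` with the exponents packaged as elements of `TorIdx r`. -/
noncomputable def cs (m e : TorIdx r) : CF r := consSum r m.1 m.2 e.1 e.2

theorem cs_eq_sum (m e : TorIdx r) :
    cs m e = ∑ l, (((Fin.cons m.1 m.2 : Fin (r + 1) → ℤ) l : ℤ) : ℂ) • single (l, e) (1 : ℂ) := by
  simp [cs, consSum]

theorem cs_add (m n e : TorIdx r) : cs (m + n) e = cs m e + cs n e := by
  simp only [cs_eq_sum, ← Finset.sum_add_distrib, ← add_smul]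
  refine Finset.sum_congr rfl fun l _ => ?_
  congr 1
  refine Fin.cases ?_ (fun i => ?_) l <;> simp

theorem cs_self_mem (m : TorIdx r) : cs m m ∈ RR r :=
  Submodule.subset_span ⟨m.1, m.2, rfl⟩

theorem mkQ_cs_self (m : TorIdx r) : (RR r).mkQ (cs m m) = 0 := by
  simpa using cs_self_mem m

section Current

variable (r) (g : Type*) [LieRing g] [LieAlgebra ℂ g] (k : ℂ) (B : g →ₗ[ℂ] g →ₗ[ℂ] ℂ)

/-- `ggPart` as a bilinear map. -/
noncomputable def ggL : (TorIdx r →₀ g) →ₗ[ℂ] (TorIdx r →₀ g) →ₗ[ℂ] (TorIdx r →₀ g) :=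
  bilinSum fun p q => (LieModule.toEnd ℂ g g : g →ₗ[ℂ] g →ₗ[ℂ] g).compr₂ (lsingle (p + q))

/-- `centPart` as a bilinear map. -/
noncomputable def centL : (TorIdx r →₀ g) →ₗ[ℂ] (TorIdx r →₀ g) →ₗ[ℂ] CF r :=
  bilinSum fun p q => B.compr₂ (LinearMap.toSpanSingleton ℂ (CF r) (k • cs p (p + q)))

/-- `actG` as a bilinear map. -/
noncomputable def actGL : DPlus r →ₗ[ℂ] (TorIdx r →₀ g) →ₗ[ℂ] (TorIdx r →₀ g) :=
  bilinSum fun p q => (LinearMap.lsmul ℂ g).compr₂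
    (((q.2 p.1 : ℤ) : ℂ) • (lsingle (p.2 + q) : g →ₗ[ℂ] TorIdx r →₀ g))

theorem ggL_apply (f f' : TorIdx r →₀ g) : ggL r g f f' = ggPart r g f f' := by
  simp [ggL, bilinSum_apply, ggPart, Prod.add_def]

theorem centL_apply (f f' : TorIdx r →₀ g) : centL r g k B f f' = centPart r g k B f f' := by
  simp [centL, bilinSum_apply, centPart, cs, smul_smul, mul_comm]

theorem actGL_apply (d : DPlus r) (f : TorIdx r →₀ g) : actGL r g d f = actG r g d f := by
  simp [actGL, bilinSum_apply, actG, derG, Finsupp.smul_sum, Prod.add_def, smul_smul]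

variable {r g}

theorem ggL_single (p q : TorIdx r) (a b : g) :
    ggL r g (single p a) (single q b) = single (p + q) ⁅a, b⁆ := by
  simp [ggL, bilinSum_single_single]

theorem centL_single (p q : TorIdx r) (a b : g) :
    centL r g k B (single p a) (single q b) = (k * B a b) • cs p (p + q) := by
  simp [centL, bilinSum_single_single, smul_smul, mul_comm]

theorem actGL_single (i : Fin r) (p q : TorIdx r) (c : ℂ) (a : g) :
    actGL r g (single (i, p) c) (single q a) =
      (c * ((q.2 i : ℤ) : ℂ)) • single (p + q) a := by
  simp [actGL, bilinSum_single_single, smul_smul]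

end Current

variable (r)

/-- `actD` as a bilinear map. -/
noncomputable def actDL : DPlus r →ₗ[ℂ] CF r →ₗ[ℂ] CF r :=
  bilinSum fun p q => (LinearMap.mul ℂ ℂ).compr₂ (LinearMap.toSpanSingleton ℂ (CF r)
    (((q.2.2 p.1 : ℤ) : ℂ) • single (q.1, p.2 + q.2) 1 +
      (if q.1 = p.1.succ then (1 : ℂ) else 0) • cs p.2 (p.2 + q.2)))

/-- `brD` as a bilinear map. -/
noncomputable def brDL : DPlus r →ₗ[ℂ] DPlus r →ₗ[ℂ] DPlus r :=
  bilinSum fun p q => (LinearMap.mul ℂ ℂ).compr₂ (LinearMap.toSpanSingleton ℂ (DPlus r)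
    (((q.2.2 p.1 : ℤ) : ℂ) • single (q.1, p.2 + q.2) 1 -
      ((p.2.2 q.1 : ℤ) : ℂ) • single (p.1, p.2 + q.2) 1))

/-- `ddCocycle` as a bilinear map. -/
noncomputable def ddL : DPlus r →ₗ[ℂ] DPlus r →ₗ[ℂ] CF r :=
  bilinSum fun p q => (LinearMap.mul ℂ ℂ).compr₂ (LinearMap.toSpanSingleton ℂ (CF r)
    (-(((q.2.2 p.1 : ℤ) : ℂ) * ((p.2.2 q.1 : ℤ) : ℂ)) • cs p.2 (p.2 + q.2)))

theorem actDL_apply (d : DPlus r) (u : CF r) : actDL r d u = actD r d u := by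
  simp only [actDL, bilinSum_apply, actD, derK, Finsupp.smul_sum]
  refine Finsupp.sum_congr fun p _ => Finsupp.sum_congr fun q _ => ?_
  simp only [LinearMap.compr₂_apply, LinearMap.mul_apply', LinearMap.toSpanSingleton_apply,
    smul_single_one, ite_smul, one_smul, zero_smul, mul_smul]
  rfl

theorem brDL_apply (d e : DPlus r) : brDL r d e = brD r d e := by
  simp [brDL, bilinSum_apply, brD, Prod.add_def]

theorem ddL_apply (d e : DPlus r) : ddL r d e = ddCocycle r d e := by
  simp [ddL, bilinSum_apply, ddCocycle, cs, smul_smul, mul_assoc]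

variable {r}

theorem actDL_single (i : Fin r) (p : TorIdx r) (j : Fin (r + 1)) (q : TorIdx r) (c c' : ℂ) :
    actDL r (single (i, p) c) (single (j, q) c') = (c * c') •
      (((q.2 i : ℤ) : ℂ) • single (j, p + q) (1 : ℂ) +
        (if j = i.succ then (1 : ℂ) else 0) • cs p (p + q)) := by
  rw [actDL, bilinSum_single_single]
  rfl

theorem brDL_single (i j : Fin r) (p q : TorIdx r) (c c' : ℂ) :
    brDL r (single (i, p) c) (single (j, q) c') = (c * c') •
      (((q.2 i : ℤ) : ℂ) • single (j, p + q) (1 : ℂ) -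
        ((p.2 j : ℤ) : ℂ) • single (i, p + q) (1 : ℂ)) := by
  rw [brDL, bilinSum_single_single]
  rfl

theorem ddL_single (i j : Fin r) (p q : TorIdx r) (c c' : ℂ) :
    ddL r (single (i, p) c) (single (j, q) c') = (c * c') •
      (-(((q.2 i : ℤ) : ℂ) * ((p.2 j : ℤ) : ℂ)) • cs p (p + q)) := by
  rw [ddL, bilinSum_single_single]
  rfl

theorem actDL_single_cs (i : Fin r) (p m e : TorIdx r) (c : ℂ) :
    actDL r (single (i, p) c) (cs m e) =
      c • (((e.2 i : ℤ) : ℂ) • cs m (p + e) + ((m.2 i : ℤ) : ℂ) • cs p (p + e)) := by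
  rw [cs_eq_sum m e, cs_eq_sum m (p + e), map_sum]
  simp only [map_smul, actDL_single, mul_one, smul_add, Finset.sum_add_distrib, Finset.smul_sum]
  congr 1
  · exact Finset.sum_congr rfl fun l _ => by module
  · rw [Finset.sum_eq_single i.succ (fun l _ hl => by simp [hl]) (by simp)]
    simp only [Fin.cons_succ, if_true]
    module

theorem actDL_mem (d : DPlus r) {u : CF r} (hu : u ∈ RR r) : actDL r d u ∈ RR r := by
  induction d using Finsupp.induction_linear with
  | zero => simp
  | add d e hd he => simpa using add_mem hd he
  | single i c =>
    obtain ⟨i, p⟩ := i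
    refine (Submodule.span_le (p := (RR r).comap (actDL r (single (i, p) c)))).2 ?_ hu
    rintro _ ⟨m₀, m, rfl⟩
    have h : actDL r (single (i, p) c) (cs (m₀, m) (m₀, m)) =
        (c * ((m i : ℤ) : ℂ)) • cs (p + (m₀, m)) (p + (m₀, m)) := by
      rw [actDL_single_cs, cs_add p]
      module
    change actDL r (single (i, p) c) (cs (m₀, m) (m₀, m)) ∈ RR r
    rw [h]
    exact Submodule.smul_mem _ _ (cs_self_mem _)

variable (r) in
/-- The action of `D_+` on the quotient `K`. -/
noncomputable def actK : DPlus r →ₗ[ℂ] (CF r ⧸ RR r) →ₗ[ℂ] (CF r ⧸ RR r) :=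
  ((RR r).liftQ ((actDL r).compr₂ (RR r).mkQ).flip (fun u hu => by
    rw [LinearMap.mem_ker]
    refine LinearMap.ext fun d => ?_
    simpa using actDL_mem d hu)).flip

theorem actK_mkQ (d : DPlus r) (u : CF r) :
    actK r d ((RR r).mkQ u) = (RR r).mkQ (actDL r d u) := rfl

section Identities

variable {g : Type*} [LieRing g] [LieAlgebra ℂ g] (k : ℂ) (B : g →ₗ[ℂ] g →ₗ[ℂ] ℂ)

theorem ggL_skew (f f' : TorIdx r →₀ g) : ggL r g f f' + ggL r g f' f = 0 := by
  induction f using Finsupp.induction_linear with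
  | zero => simp
  | add f₁ f₂ h₁ h₂ =>
    simp only [map_add, LinearMap.add_apply]
    linear_combination (norm := module) h₁ + h₂
  | single p a =>
  induction f' using Finsupp.induction_linear with
  | zero => simp
  | add f₁ f₂ h₁ h₂ =>
    simp only [map_add, LinearMap.add_apply]
    linear_combination (norm := module) h₁ + h₂
  | single q b =>
  rw [ggL_single, ggL_single, add_comm q p, ← single_add, ← lie_skew a b, neg_add_cancel,
    single_zero]

theorem ggL_jacobi (f₁ f₂ f₃ : TorIdx r →₀ g) :
    ggL r g f₁ (ggL r g f₂ f₃) + ggL r g f₂ (ggL r g f₃ f₁) + ggL r g f₃ (ggL r g f₁ f₂) = 0 := by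
  induction f₁ using Finsupp.induction_linear with
  | zero => simp
  | add f f' h h' =>
    simp only [map_add, LinearMap.add_apply]
    linear_combination (norm := module) h + h'
  | single p a =>
  induction f₂ using Finsupp.induction_linear with
  | zero => simp
  | add f f' h h' =>
    simp only [map_add, LinearMap.add_apply]
    linear_combination (norm := module) h + h'
  | single q b =>
  induction f₃ using Finsupp.induction_linear with
  | zero => simp
  | add f f' h h' =>
    simp only [map_add, LinearMap.add_apply]
    linear_combination (norm := module) h + h'
  | single s c =>
  simp only [ggL_single]
  rw [show q + (s + p) = p + (q + s) by abel, show s + (p + q) = p + (q + s) by abel,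
    ← single_add, ← single_add, lie_jacobi, single_zero]

theorem actGL_ggL (d : DPlus r) (f f' : TorIdx r →₀ g) :
    actGL r g d (ggL r g f f') = ggL r g (actGL r g d f) f' + ggL r g f (actGL r g d f') := by
  induction d using Finsupp.induction_linear with
  | zero => simp
  | add d d' h h' =>
    simp only [map_add, LinearMap.add_apply]
    linear_combination (norm := module) h + h'
  | single i c =>
  induction f using Finsupp.induction_linear with
  | zero => simp
  | add f f' h h' =>
    simp only [map_add, LinearMap.add_apply]
    linear_combination (norm := module) h + h'
  | single p a =>
  induction f' using Finsupp.induction_linear with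
  | zero => simp
  | add f f' h h' =>
    simp only [map_add]
    linear_combination (norm := module) h + h'
  | single q b =>
  obtain ⟨i, m⟩ := i
  simp only [ggL_single, actGL_single, map_smul, LinearMap.smul_apply]
  rw [show m + p + q = m + (p + q) by abel, show p + (m + q) = m + (p + q) by abel]
  simp only [Prod.snd_add, Pi.add_apply, Int.cast_add]
  module

theorem actGL_brDL (d e : DPlus r) (f : TorIdx r →₀ g) :
    actGL r g (brDL r d e) f = actGL r g d (actGL r g e f) - actGL r g e (actGL r g d f) := by
  induction d using Finsupp.induction_linear with
  | zero => simp
  | add d d' h h' =>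
    simp only [map_add, LinearMap.add_apply]
    linear_combination (norm := module) h + h'
  | single i c =>
  induction e using Finsupp.induction_linear with
  | zero => simp
  | add d d' h h' =>
    simp only [map_add, LinearMap.add_apply]
    linear_combination (norm := module) h + h'
  | single j c' =>
  induction f using Finsupp.induction_linear with
  | zero => simp
  | add f f' h h' =>
    simp only [map_add]
    linear_combination (norm := module) h + h'
  | single s a =>
  obtain ⟨i, p⟩ := i
  obtain ⟨j, q⟩ := j
  simp only [brDL_single, actGL_single, map_smul, map_sub, LinearMap.smul_apply,
    LinearMap.sub_apply]
  rw [show p + q + s = p + (q + s) by abel, show q + (p + s) = p + (q + s) by abel]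
  simp only [Prod.snd_add, Pi.add_apply, Int.cast_add]
  module

theorem brDL_skew (d e : DPlus r) : brDL r d e + brDL r e d = 0 := by
  induction d using Finsupp.induction_linear with
  | zero => simp
  | add d d' h h' =>
    simp only [map_add, LinearMap.add_apply]
    linear_combination (norm := module) h + h'
  | single i c =>
  induction e using Finsupp.induction_linear with
  | zero => simp
  | add d d' h h' =>
    simp only [map_add, LinearMap.add_apply]
    linear_combination (norm := module) h + h'
  | single j c' =>
  obtain ⟨i, p⟩ := i
  obtain ⟨j, q⟩ := j
  simp only [brDL_single]
  rw [add_comm q p]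
  module

theorem brDL_jacobi (d₁ d₂ d₃ : DPlus r) :
    brDL r d₁ (brDL r d₂ d₃) + brDL r d₂ (brDL r d₃ d₁) + brDL r d₃ (brDL r d₁ d₂) = 0 := by
  induction d₁ using Finsupp.induction_linear with
  | zero => simp
  | add d d' h h' =>
    simp only [map_add, LinearMap.add_apply]
    linear_combination (norm := module) h + h'
  | single i a =>
  induction d₂ using Finsupp.induction_linear with
  | zero => simp
  | add d d' h h' =>
    simp only [map_add, LinearMap.add_apply]
    linear_combination (norm := module) h + h'
  | single j b =>
  induction d₃ using Finsupp.induction_linear with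
  | zero => simp
  | add d d' h h' =>
    simp only [map_add, LinearMap.add_apply]
    linear_combination (norm := module) h + h'
  | single l c =>
  obtain ⟨i, p⟩ := i
  obtain ⟨j, q⟩ := j
  obtain ⟨l, s⟩ := l
  simp only [brDL_single, map_smul, map_sub]
  rw [show q + (s + p) = p + (q + s) by abel, show s + (p + q) = p + (q + s) by abel]
  simp only [Prod.snd_add, Pi.add_apply, Int.cast_add]
  module

theorem actDL_brDL (d e : DPlus r) (u : CF r) :
    actDL r (brDL r d e) u = actDL r d (actDL r e u) - actDL r e (actDL r d u) := by
  induction d using Finsupp.induction_linear with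
  | zero => simp
  | add d d' h h' =>
    simp only [map_add, LinearMap.add_apply]
    linear_combination (norm := module) h + h'
  | single i c =>
  induction e using Finsupp.induction_linear with
  | zero => simp
  | add d d' h h' =>
    simp only [map_add, LinearMap.add_apply]
    linear_combination (norm := module) h + h'
  | single j c' =>
  induction u using Finsupp.induction_linear with
  | zero => simp
  | add f f' h h' =>
    simp only [map_add]
    linear_combination (norm := module) h + h'
  | single l a =>
  obtain ⟨i, p⟩ := i
  obtain ⟨j, q⟩ := j
  obtain ⟨l, s⟩ := l
  simp only [brDL_single, actDL_single, actDL_single_cs, map_smul, map_sub, map_add,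
    LinearMap.smul_apply, LinearMap.sub_apply, cs_add]
  rw [show p + q + s = p + (q + s) by abel, show q + (p + s) = p + (q + s) by abel]
  simp only [Prod.snd_add, Pi.add_apply, Int.cast_add]
  module

theorem actK_brDL (d e : DPlus r) (u : CF r ⧸ RR r) :
    actK r (brDL r d e) u = actK r d (actK r e u) - actK r e (actK r d u) := by
  obtain ⟨u, rfl⟩ := (RR r).mkQ_surjective u
  simp only [actK_mkQ, actDL_brDL, map_sub]

theorem actDL_centL (d : DPlus r) (f f' : TorIdx r →₀ g) :
    actDL r d (centL r g k B f f') =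
      centL r g k B (actGL r g d f) f' + centL r g k B f (actGL r g d f') := by
  induction d using Finsupp.induction_linear with
  | zero => simp
  | add d d' h h' =>
    simp only [map_add, LinearMap.add_apply]
    linear_combination (norm := module) h + h'
  | single i c =>
  induction f using Finsupp.induction_linear with
  | zero => simp
  | add f f' h h' =>
    simp only [map_add, LinearMap.add_apply]
    linear_combination (norm := module) h + h'
  | single p a =>
  induction f' using Finsupp.induction_linear with
  | zero => simp
  | add f f' h h' =>
    simp only [map_add]
    linear_combination (norm := module) h + h'
  | single q b =>
  obtain ⟨i, m⟩ := i
  simp only [centL_single, actGL_single, actDL_single_cs, map_smul, LinearMap.smul_apply, cs_add]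
  rw [show m + p + q = m + (p + q) by abel, show p + (m + q) = m + (p + q) by abel]
  simp only [Prod.snd_add, Pi.add_apply, Int.cast_add]
  module

theorem mkQ_centL_skew (hsymm : ∀ a b : g, B a b = B b a) (f f' : TorIdx r →₀ g) :
    (RR r).mkQ (centL r g k B f f') + (RR r).mkQ (centL r g k B f' f) = 0 := by
  induction f using Finsupp.induction_linear with
  | zero => simp
  | add f₁ f₂ h₁ h₂ =>
    simp only [map_add, LinearMap.add_apply]
    linear_combination (norm := module) h₁ + h₂
  | single p a =>
  induction f' using Finsupp.induction_linear with
  | zero => simp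
  | add f₁ f₂ h₁ h₂ =>
    simp only [map_add, LinearMap.add_apply]
    linear_combination (norm := module) h₁ + h₂
  | single q b =>
  have h := mkQ_cs_self (p + q)
  rw [cs_add, map_add] at h
  rw [centL_single, centL_single, add_comm q p, hsymm b a, map_smul, map_smul]
  linear_combination (norm := module) (k * B a b) • h

theorem mkQ_centL_jacobi (hsymm : ∀ a b : g, B a b = B b a)
    (hinv : ∀ a b c : g, B ⁅a, b⁆ c = B a ⁅b, c⁆) (f₁ f₂ f₃ : TorIdx r →₀ g) :
    (RR r).mkQ (centL r g k B f₁ (ggL r g f₂ f₃)) + (RR r).mkQ (centL r g k B f₂ (ggL r g f₃ f₁)) +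
      (RR r).mkQ (centL r g k B f₃ (ggL r g f₁ f₂)) = 0 := by
  induction f₁ using Finsupp.induction_linear with
  | zero => simp
  | add f f' h h' =>
    simp only [map_add, LinearMap.add_apply] at h h' ⊢
    linear_combination (norm := module) h + h'
  | single p a =>
  induction f₂ using Finsupp.induction_linear with
  | zero => simp
  | add f f' h h' =>
    simp only [map_add, LinearMap.add_apply] at h h' ⊢
    linear_combination (norm := module) h + h'
  | single q b =>
  induction f₃ using Finsupp.induction_linear with
  | zero => simp
  | add f f' h h' =>
    simp only [map_add, LinearMap.add_apply] at h h' ⊢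
    linear_combination (norm := module) h + h'
  | single s c =>
  have h := mkQ_cs_self (p + (q + s))
  rw [cs_add, cs_add, map_add, map_add] at h
  simp only [ggL_single, centL_single, map_smul]
  rw [show q + (s + p) = p + (q + s) by abel, show s + (p + q) = p + (q + s) by abel,
    show B b ⁅c, a⁆ = B a ⁅b, c⁆ by rw [← hinv, hsymm],
    show B c ⁅a, b⁆ = B a ⁅b, c⁆ by rw [hsymm, hinv]]
  linear_combination (norm := module) (k * B a ⁅b, c⁆) • h

theorem mkQ_ddL_skew (d e : DPlus r) :
    (RR r).mkQ (ddL r d e) + (RR r).mkQ (ddL r e d) = 0 := by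
  induction d using Finsupp.induction_linear with
  | zero => simp
  | add d d' h h' =>
    simp only [map_add, LinearMap.add_apply]
    linear_combination (norm := module) h + h'
  | single i c =>
  induction e using Finsupp.induction_linear with
  | zero => simp
  | add d d' h h' =>
    simp only [map_add, LinearMap.add_apply]
    linear_combination (norm := module) h + h'
  | single j c' =>
  obtain ⟨i, p⟩ := i
  obtain ⟨j, q⟩ := j
  have h := mkQ_cs_self (p + q)
  rw [cs_add, map_add] at h
  rw [ddL_single, ddL_single, add_comm q p]
  simp only [map_smul]
  linear_combination (norm := module)
    (-(c * c' * ((q.2 i : ℤ) : ℂ) * ((p.2 j : ℤ) : ℂ))) • h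

theorem mkQ_ddL_cocycle (d₁ d₂ d₃ : DPlus r) :
    (RR r).mkQ (ddL r d₁ (brDL r d₂ d₃) + actDL r d₁ (ddL r d₂ d₃)) +
      (RR r).mkQ (ddL r d₂ (brDL r d₃ d₁) + actDL r d₂ (ddL r d₃ d₁)) +
      (RR r).mkQ (ddL r d₃ (brDL r d₁ d₂) + actDL r d₃ (ddL r d₁ d₂)) = 0 := by
  induction d₁ using Finsupp.induction_linear with
  | zero => simp
  | add d d' h h' =>
    simp only [map_add, LinearMap.add_apply] at h h' ⊢
    linear_combination (norm := module) h + h'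
  | single i a =>
  induction d₂ using Finsupp.induction_linear with
  | zero => simp
  | add d d' h h' =>
    simp only [map_add, LinearMap.add_apply] at h h' ⊢
    linear_combination (norm := module) h + h'
  | single j b =>
  induction d₃ using Finsupp.induction_linear with
  | zero => simp
  | add d d' h h' =>
    simp only [map_add, LinearMap.add_apply] at h h' ⊢
    linear_combination (norm := module) h + h'
  | single l c =>
  obtain ⟨i, p⟩ := i
  obtain ⟨j, q⟩ := j
  obtain ⟨l, s⟩ := l
  have h := mkQ_cs_self (p + (q + s))
  rw [cs_add, cs_add, map_add, map_add] at h
  simp only [brDL_single, ddL_single, actDL_single_cs, map_smul, map_sub, map_add]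
  rw [show q + (s + p) = p + (q + s) by abel, show s + (p + q) = p + (q + s) by abel]
  simp only [Prod.snd_add, Pi.add_apply, Int.cast_add]
  linear_combination (norm := module)
    ((a * b * c) * (-(s.2 j * q.2 i * p.2 l) - s.2 j * s.2 i * p.2 l + q.2 l * s.2 i * p.2 j
      - s.2 j * q.2 l * q.2 i - q.2 i * p.2 j * p.2 l : ℂ)) • h

end Identities

/-- The bracket of the full toroidal Lie algebra. -/
noncomputable def bracket {g : Type*} [LieRing g] [LieAlgebra ℂ g] (k : ℂ)
    (B : g →ₗ[ℂ] g →ₗ[ℂ] ℂ) (x y : (TorIdx r →₀ g) × (CF r ⧸ RR r) × DPlus r) :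
    (TorIdx r →₀ g) × (CF r ⧸ RR r) × DPlus r :=
  (ggL r g x.1 y.1 + actGL r g x.2.2 y.1 - actGL r g y.2.2 x.1,
    (RR r).mkQ (centL r g k B x.1 y.1) + actK r x.2.2 y.2.1 - actK r y.2.2 x.2.1 +
      (RR r).mkQ (ddL r x.2.2 y.2.2),
    brDL r x.2.2 y.2.2)

section Bracket

variable {g : Type*} [LieRing g] [LieAlgebra ℂ g] (k : ℂ) (B : g →ₗ[ℂ] g →ₗ[ℂ] ℂ)

theorem bracket_self (hsymm : ∀ a b : g, B a b = B b a)
    (x : (TorIdx r →₀ g) × (CF r ⧸ RR r) × DPlus r) : bracket k B x x = 0 := by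
  obtain ⟨f, u, d⟩ := x
  refine Prod.ext ?_ (Prod.ext ?_ ?_) <;>
    simp only [bracket, Prod.fst_zero, Prod.snd_zero]
  · linear_combination (norm := module) (1 / 2 : ℂ) • ggL_skew f f
  · linear_combination (norm := module)
      (1 / 2 : ℂ) • mkQ_centL_skew k B hsymm f f + (1 / 2 : ℂ) • mkQ_ddL_skew d d
  · linear_combination (norm := module) (1 / 2 : ℂ) • brDL_skew d d

theorem bracket_jacobi (hsymm : ∀ a b : g, B a b = B b a)
    (hinv : ∀ a b c : g, B ⁅a, b⁆ c = B a ⁅b, c⁆)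
    (x y z : (TorIdx r →₀ g) × (CF r ⧸ RR r) × DPlus r) :
    bracket k B x (bracket k B y z) + bracket k B y (bracket k B z x) +
      bracket k B z (bracket k B x y) = 0 := by
  obtain ⟨f₁, u₁, d₁⟩ := x
  obtain ⟨f₂, u₂, d₂⟩ := y
  obtain ⟨f₃, u₃, d₃⟩ := z
  refine Prod.ext ?_ (Prod.ext ?_ ?_) <;>
    simp only [bracket, Prod.fst_add, Prod.snd_add, Prod.fst_zero, Prod.snd_zero, map_add, map_sub]
  · simp only [actGL_ggL, actGL_brDL]
    linear_combination (norm := module) ggL_jacobi f₁ f₂ f₃ +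
      ggL_skew (actGL r g d₁ f₂) f₃ + ggL_skew (actGL r g d₂ f₃) f₁ +
      ggL_skew (actGL r g d₃ f₁) f₂
  · have h := mkQ_ddL_cocycle d₁ d₂ d₃
    simp only [map_add] at h
    simp only [actK_brDL, actK_mkQ, actDL_centL, map_add]
    linear_combination (norm := module) h + mkQ_centL_jacobi k B hsymm hinv f₁ f₂ f₃ +
      mkQ_centL_skew k B hsymm (actGL r g d₁ f₂) f₃ +
      mkQ_centL_skew k B hsymm (actGL r g d₂ f₃) f₁ +
      mkQ_centL_skew k B hsymm (actGL r g d₃ f₁) f₂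
  · exact brDL_jacobi d₁ d₂ d₃

end Bracket

end Toroidal

/-- the vector space
`L̂_{r+1,k}(g) = (g ⊗ O) ⊕ K ⊕ D_+` carries a well-defined bracket given by the
stated formulas (in particular the `K`-components are well defined on the
quotient `K`), and this bracket is bilinear, alternating and satisfies the
Jacobi identity, so `L̂_{r+1,k}(g)` is a Lie algebra over `ℂ`. -/
theorem full_toroidal_isLieAlgebra
    (r : ℕ) (hr : 1 ≤ r)
    (g : Type*) [LieRing g] [LieAlgebra ℂ g]
    (k : ℂ) (B : g →ₗ[ℂ] g →ₗ[ℂ] ℂ)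
    (hsymm : ∀ a b : g, B a b = B b a)
    (hinv : ∀ a b c : g, B ⁅a, b⁆ c = B a ⁅b, c⁆) :
    ∃ br : (TorIdx r →₀ g) × (CF r ⧸ RR r) × DPlus r →
           (TorIdx r →₀ g) × (CF r ⧸ RR r) × DPlus r →
           (TorIdx r →₀ g) × (CF r ⧸ RR r) × DPlus r,
      (∀ (f f' : TorIdx r →₀ g) (u v : CF r) (d e : DPlus r),
        br (f, (RR r).mkQ u, d) (f', (RR r).mkQ v, e) =
          (ggPart r g f f' + actG r g d f' - actG r g e f,
           (RR r).mkQ (centPart r g k B f f' + actD r d v - actD r e u + ddCocycle r d e),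
           brD r d e)) ∧
      (∀ x y z, br (x + y) z = br x z + br y z) ∧
      (∀ x y z, br x (y + z) = br x y + br x z) ∧
      (∀ (c : ℂ) x y, br (c • x) y = c • br x y) ∧
      (∀ (c : ℂ) x y, br x (c • y) = c • br x y) ∧
      (∀ x, br x x = 0) ∧
      (∀ x y z, br x (br y z) + br y (br z x) + br z (br x y) = 0) := by
  refine ⟨Toroidal.bracket k B, fun f f' u v d e => ?_, fun x y z => ?_, fun x y z => ?_,
    fun c x y => ?_, fun c x y => ?_, Toroidal.bracket_self k B hsymm,
    Toroidal.bracket_jacobi k B hsymm hinv⟩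
  · simp only [Toroidal.bracket, Toroidal.actK_mkQ, Toroidal.ggL_apply, Toroidal.centL_apply,
      Toroidal.actGL_apply, Toroidal.actDL_apply, Toroidal.brDL_apply, Toroidal.ddL_apply,
      map_add, map_sub]
  all_goals
    refine Prod.ext ?_ (Prod.ext ?_ ?_) <;>
      simp only [Toroidal.bracket, Prod.fst_add, Prod.snd_add, Prod.smul_fst, Prod.smul_snd,
        map_add, map_smul, LinearMap.add_apply, LinearMap.smul_apply] <;>
      module
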